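/- arXiv:1606.04025 — 2 statements merged into one kernel-verified Lean document; each statement's English description precedes it below -/
import Mathlib

section
/- For an ordinal κ, the space κ is hemicompact and not countably compact if and only if the cofinality of κ equals ω. -/
open Topology

/-- `Cp X` is the space `C(X, ℝ)` endowed with the topology of pointwise convergence. -/
def Cp (X : Type*) [TopologicalSpace X] : Type _ := C(X, ℝ)

namespace Cp

variable {X : Type*} [TopologicalSpace X]

instance : FunLike (Cp X) X ℝ where
  coe f := ⇑(show C(X, ℝ) from f)
  coe_injective := ContinuousMap.coe_injective

/-- The topology of pointwise convergence on `Cp X`. -/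
instance : TopologicalSpace (Cp X) :=
  TopologicalSpace.induced (fun f : Cp X => (f : X → ℝ)) Pi.topologicalSpace

end Cp

/-- A topological space `Y` is Ascoli if the canonical evaluation map
`Y → C_k(C_k(Y))`, `y ↦ (f ↦ f y)`, is a topological embedding (here `C(·, ℝ)`
carries the compact-open topology). -/
def AscoliSpace (Y : Type*) [TopologicalSpace Y] : Prop :=
  IsEmbedding fun y : Y =>
    (⟨fun f : C(Y, ℝ) => f y, ContinuousEvalConst.continuous_eval_const y⟩ : C(C(Y, ℝ), ℝ))

/-- A topological space `Y` is a `k_ℝ`-space if every real-valued function whose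
restriction to every compact subset is continuous is itself continuous. -/
def KRSpace (Y : Type*) [TopologicalSpace Y] : Prop :=
  ∀ g : Y → ℝ, (∀ K : Set Y, IsCompact K → ContinuousOn g K) → Continuous g

/-- A topological space is scattered if every nonempty subset has a point isolated in it. -/
def Scattered (X : Type*) [TopologicalSpace X] : Prop :=
  ∀ A : Set X, A.Nonempty → ∃ a ∈ A, ∃ U : Set X, IsOpen U ∧ U ∩ A = {a}

/-- A space is hemicompact if it has a countable family of compact sets such that every
compact subset is contained in one of them. -/
def Hemicompact (X : Type*) [TopologicalSpace X] : Prop :=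
  ∃ K : ℕ → Set X, (∀ n, IsCompact (K n)) ∧ ∀ C : Set X, IsCompact C → ∃ n, C ⊆ K n

/-- A space is countably compact if every countable open cover has a finite subcover. -/
def CountablyCompact (X : Type*) [TopologicalSpace X] : Prop :=
  ∀ U : ℕ → Set X, (∀ n, IsOpen (U n)) → (⋃ n, U n) = Set.univ →
    ∃ s : Finset ℕ, (⋃ n ∈ s, U n) = Set.univ

open Set Cardinal

theorem exists_seq_isCofinal_range_of_cof_eq_aleph0 {X : Type*} [LinearOrder X]
    (h : Order.cof X = ℵ₀) :
    ∃ f : ℕ → X, IsCofinal (range f) := by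
  have hX : Nonempty X := Order.cof_ne_zero_iff.1 (h ▸ aleph0_ne_zero)
  obtain ⟨s, hs, hcard⟩ := Order.exists_cof_eq X
  have hcount : s.Countable := le_aleph0_iff_set_countable.1 (hcard.trans h).le
  obtain ⟨f, rfl⟩ := hcount.exists_eq_range hs.nonempty
  exact ⟨f, hs⟩

section LinearOrder

variable {X : Type*} [TopologicalSpace X]

theorem CountablyCompact.of_compactSpace [CompactSpace X] : CountablyCompact X := by
  intro U hU hcover
  obtain ⟨s, hs⟩ := isCompact_univ.elim_finite_subcover U hU hcover.ge
  exact ⟨s, univ_subset_iff.1 hs⟩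

variable [LinearOrder X]

theorem Hemicompact.cof_le_aleph0 [ClosedIciTopology X] (h : Hemicompact X) :
    Order.cof X ≤ ℵ₀ := by
  rcases isEmpty_or_nonempty X with hX | hX
  · simp
  obtain ⟨K, hK, hsub⟩ := h
  choose b hb using fun n => (hK n).bddAbove
  have hcof : IsCofinal (range b) := fun x => by
    obtain ⟨n, hn⟩ := hsub {x} isCompact_singleton
    exact ⟨b n, mem_range_self n, hb n (hn rfl)⟩
  exact (Order.cof_le hcof).trans (countable_range b).le_aleph0

theorem compactSpace_of_cof_lt_aleph0 (hIic : ∀ a : X, IsCompact (Iic a))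
    (h : Order.cof X < ℵ₀) : CompactSpace X := by
  rcases isEmpty_or_nonempty X with hX | hX
  · infer_instance
  obtain ⟨a, ha⟩ := Order.cof_le_one_iff.1 (Order.cof_lt_aleph0_iff.1 h)
  exact ⟨(hIic a).of_isClosed_subset isClosed_univ fun x _ => ha x⟩

theorem Hemicompact.of_isCofinal_range [ClosedIciTopology X]
    (hIic : ∀ a : X, IsCompact (Iic a)) {f : ℕ → X} (hf : IsCofinal (range f)) :
    Hemicompact X := by
  refine ⟨fun n => Iic (f n), fun n => hIic _, fun C hC => ?_⟩
  have : Nonempty X := ⟨f 0⟩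
  obtain ⟨b, hb⟩ := hC.bddAbove
  obtain ⟨_, ⟨n, rfl⟩, hn⟩ := hf b
  exact ⟨n, fun x hx => (hb hx).trans hn⟩

theorem not_countablyCompact_of_isCofinal_range [ClosedIciTopology X] [NoMaxOrder X]
    {f : ℕ → X} (hf : IsCofinal (range f)) : ¬ CountablyCompact X := by
  intro h
  obtain ⟨s, hs⟩ := h (fun n => Iio (f n)) (fun n => isOpen_Iio) <| by
    refine eq_univ_of_forall fun x => ?_
    obtain ⟨y, hxy⟩ := exists_gt x
    obtain ⟨_, ⟨n, rfl⟩, hn⟩ := hf y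
    exact mem_iUnion.2 ⟨n, hxy.trans_le hn⟩
  have : Nonempty X := ⟨f 0⟩
  obtain ⟨b, hb⟩ := (s.finite_toSet.image f).bddAbove
  obtain ⟨n, hn, hbn⟩ := mem_iUnion₂.1 (hs.ge (mem_univ b))
  exact (hb (mem_image_of_mem f hn)).not_gt hbn

/-- For linear orders with compact initial segments, the property of being hemicompact but not
countably compact characterizes countably infinite cofinality. -/
theorem hemicompact_not_countablyCompact_iff_cof_eq_aleph0 [ClosedIciTopology X]
    (hIic : ∀ a : X, IsCompact (Iic a)) :
    (Hemicompact X ∧ ¬ CountablyCompact X) ↔ Order.cof X = ℵ₀ := by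
  constructor
  · rintro ⟨hh, hc⟩
    refine hh.cof_le_aleph0.eq_of_not_lt fun hlt => hc ?_
    have := compactSpace_of_cof_lt_aleph0 hIic hlt
    exact .of_compactSpace
  · intro h
    obtain ⟨f, hf⟩ := exists_seq_isCofinal_range_of_cof_eq_aleph0 h
    have : NoTopOrder X := Order.cof_ne_one_iff.1 (h ▸ one_lt_aleph0.ne')
    have : NoMaxOrder X := NoTopOrder.to_noMaxOrder X
    exact ⟨.of_isCofinal_range hIic hf, not_countablyCompact_of_isCofinal_range hf⟩

end LinearOrder

theorem Ordinal.isCompact_Iic_Iio {κ : Ordinal} (a : Iio κ) : IsCompact (Iic a) := by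
  rw [Subtype.isCompact_iff]
  convert isCompact_Icc (a := (0 : Ordinal)) (b := a) using 1
  ext x
  simp only [mem_image, mem_Iic, mem_Icc, zero_le, true_and]
  exact ⟨fun ⟨y, hy, hyx⟩ => hyx ▸ hy, fun hx => ⟨⟨x, hx.trans_lt a.2⟩, hx, rfl⟩⟩

/-- The space `κ` is hemicompact and not countably compact if and only if `cf(κ) = ω`. -/
theorem ordinal_hemicompact_not_countablyCompact_iff (κ : Ordinal) :
    (Hemicompact (Set.Iio κ) ∧ ¬ CountablyCompact (Set.Iio κ)) ↔
      κ.cof = Cardinal.aleph0 := by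
  rw [hemicompact_not_countablyCompact_iff_cof_eq_aleph0 Ordinal.isCompact_Iic_Iio,
    Ordinal.cof_Iio, ← Ordinal.lift_cof, Cardinal.lift_eq_aleph0]
end

section
/- The space C_p(ω₁), where ω₁ is the first uncountable ordinal with the order topology, is an Ascoli space but is not a k_ℝ-space. -/
open Topology

open Filter Set

/-- A space is `κ`-Fréchet–Urysohn if every point in the closure of an open set is the limit of a
sequence of points of that open set. -/
def KappaFrechetUrysohn (Y : Type*) [TopologicalSpace Y] : Prop :=
  ∀ W : Set Y, IsOpen W → ∀ y ∈ closure W, ∃ u : ℕ → Y, (∀ n, u n ∈ W) ∧ Tendsto u atTop (𝓝 y)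

/-- In a `κ`-Fréchet–Urysohn space compact subsets of `C_k(Y)` are equicontinuous, that is, the
evaluation map `Y → C_k(C_k(Y))` is continuous. -/
theorem KappaFrechetUrysohn.continuous_eval {Y : Type*} [TopologicalSpace Y]
    (hY : KappaFrechetUrysohn Y) :
    Continuous fun y : Y =>
      (⟨fun f : C(Y, ℝ) => f y, ContinuousEvalConst.continuous_eval_const y⟩ : C(C(Y, ℝ), ℝ)) := by
  refine continuous_iff_continuousAt.2 fun y => ?_
  refine ContinuousMap.tendsto_iff_forall_isCompact_tendstoUniformlyOn.2 fun K hK => ?_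
  refine Metric.tendstoUniformlyOn_iff.2 fun ε hε => ?_
  by_contra hcon
  set W : Set Y := ⋃ φ ∈ K, {z | ε / 2 < dist (φ y) (φ z)} with hW
  have hWo : IsOpen W := by
    refine isOpen_biUnion fun φ _ => isOpen_lt continuous_const ?_
    exact continuous_const.dist φ.continuous
  have hyW : y ∈ closure W := by
    refine mem_closure_iff_frequently.2 fun hev => hcon ?_
    filter_upwards [hev] with z hz φ hφ
    by_contra hlt
    refine hz (mem_iUnion₂.2 ⟨φ, hφ, ?_⟩)
    have hle : ε ≤ dist (φ y) (φ z) := not_lt.1 hlt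
    show ε / 2 < dist (φ y) (φ z)
    linarith
  obtain ⟨u, huW, hu⟩ := hY W hWo y hyW
  have hex : ∀ n, ∃ φ ∈ K, ε / 2 < dist (φ y) (φ (u n)) := fun n => by
    simpa [hW] using huW n
  choose φ hφK hφ using hex
  obtain ⟨ψ, -, hψ⟩ := hK (f := map φ atTop) (tendsto_principal.2 (Eventually.of_forall hφK))
  have hunif := Metric.tendstoUniformlyOn_iff.1
    (ContinuousMap.tendsto_iff_forall_isCompact_tendstoUniformlyOn.1
      (tendsto_id (x := 𝓝 ψ)) _ hu.isCompact_insert_range) (ε / 8) (by linarith)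
  have hfreq : ∃ᶠ n in atTop, ∀ z ∈ insert y (range u), dist (ψ z) (φ n z) < ε / 8 :=
    MapClusterPt.frequently hψ hunif
  have hlim : ∀ᶠ n in atTop, dist (ψ (u n)) (ψ y) < ε / 8 :=
    Metric.tendsto_nhds.1 ((ψ.continuous.tendsto y).comp hu) _ (by linarith)
  obtain ⟨n, hn, hn'⟩ := (hfreq.and_eventually hlim).exists
  have h1 := hn y (mem_insert _ _)
  have h2 := hn (u n) (mem_insert_of_mem _ (mem_range_self n))
  have h3 := hφ n
  have h4 := dist_triangle4 (φ n y) (ψ y) (ψ (u n)) (φ n (u n))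
  rw [dist_comm (φ n y) (ψ y), dist_comm (ψ y) (ψ (u n))] at h4
  linarith

namespace Cp

variable {X : Type*} [TopologicalSpace X]

theorem isEmbedding_coe : IsEmbedding (fun f : Cp X => (f : X → ℝ)) :=
  ⟨⟨rfl⟩, DFunLike.coe_injective⟩

theorem continuous_eval (x : X) : Continuous fun f : Cp X => f x :=
  (continuous_apply x).comp isEmbedding_coe.continuous

theorem continuous_coe (f : Cp X) : Continuous f :=
  ContinuousMap.continuous (show C(X, ℝ) from f)

theorem tendsto_iff {ι : Type*} {l : Filter ι} {u : ι → Cp X} {f : Cp X} :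
    Tendsto u l (𝓝 f) ↔ ∀ x, Tendsto (fun i => u i x) l (𝓝 (f x)) := by
  rw [isEmbedding_coe.tendsto_nhds_iff, tendsto_pi_nhds]
  rfl

theorem eventually_dist_lt (f : Cp X) (s : Finset X) {δ : ℝ} (hδ : 0 < δ) :
    ∀ᶠ h in 𝓝 f, ∀ x ∈ s, dist (h x) (f x) < δ :=
  (Filter.eventually_all_finset s).2 fun x _ =>
    Metric.tendsto_nhds.1 ((continuous_eval x).tendsto f) δ hδ

theorem exists_finset_of_isOpen {W : Set (Cp X)} (hW : IsOpen W) {f : Cp X} (hf : f ∈ W) :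
    ∃ s : Finset X, ∀ h : Cp X, (∀ x ∈ s, h x = f x) → h ∈ W := by
  obtain ⟨V, hV, rfl⟩ := isOpen_induced_iff.1 hW
  obtain ⟨s, u, hu, hsub⟩ := isOpen_pi_iff.1 hV _ hf
  refine ⟨s, fun h hh => hsub fun x hx => ?_⟩
  show h x ∈ u x
  exact hh x hx ▸ (hu x hx).2

theorem ascoliSpace_of_kappaFrechetUrysohn (h : KappaFrechetUrysohn (Cp X)) :
    AscoliSpace (Cp X) := by
  refine IsEmbedding.of_comp h.continuous_eval
    (g := fun ψ : C(C(Cp X, ℝ), ℝ) => fun x : X =>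
      ψ (⟨fun f : Cp X => f x, continuous_eval x⟩ : C(Cp X, ℝ))) ?_ isEmbedding_coe
  exact continuous_pi fun x => ContinuousEvalConst.continuous_eval_const _

/-- Interpolation on a finite set relative to a given function outside a clopen set. -/
theorem exists_eqOn_finset [NormalSpace X] [T1Space X] (f : Cp X) {U : Set X} (hU : IsClopen U)
    (s : Finset X) (hs : ∀ x ∈ s, x ∈ U) (v : X → ℝ) :
    ∃ h : Cp X, (∀ x ∈ s, h x = v x) ∧ ∀ x ∉ U, h x = f x := by
  classical
  have : DiscreteTopology (s : Set X) := s.finite_toSet.isDiscrete.to_subtype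
  obtain ⟨p, hp⟩ := ContinuousMap.exists_restrict_eq s.finite_toSet.isClosed
    (⟨fun x => v x, continuous_of_discreteTopology⟩ : C((s : Set X), ℝ))
  have hc : Continuous (U.piecewise p f) :=
    continuous_piecewise (by simp [hU.frontier_eq]) p.continuous.continuousOn
      (continuous_coe f).continuousOn
  refine ⟨(⟨U.piecewise p f, hc⟩ : C(X, ℝ)), fun x hx => ?_, fun x hx => ?_⟩
  · show U.piecewise p f x = v x
    rw [piecewise_eq_of_mem _ _ _ (hs x hx)]
    exact DFunLike.congr_fun hp (⟨x, hx⟩ : (s : Set X))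
  · exact piecewise_eq_of_notMem _ _ _ hx

end Cp

section LinearOrder

variable {X : Type*} [LinearOrder X] [WellFoundedLT X] [TopologicalSpace X] [OrderTopology X]

theorem isClopen_Iic_of_wellFoundedLT [NoMaxOrder X] (a : X) : IsClopen (Iic a) := by
  refine ⟨isClosed_Iic, ?_⟩
  obtain ⟨b, hb, hmin⟩ := WellFounded.has_min (wellFounded_lt (α := X)) (Ioi a) (exists_gt a)
  have : Iic a = Iio b := by
    ext x
    exact ⟨fun hx => lt_of_le_of_lt hx hb, fun hx => not_lt.1 fun hax => hmin x hax hx⟩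
  exact this ▸ isOpen_Iio

theorem Monotone.exists_tendsto_of_bddAbove {u : ℕ → X} (hu : Monotone u)
    (hb : BddAbove (range u)) : ∃ a, (∀ n, u n ≤ a) ∧ Tendsto u atTop (𝓝 a) := by
  obtain ⟨a, ha, hmin⟩ := WellFounded.has_min (wellFounded_lt (α := X)) _ hb
  have hlub : IsLUB (range u) a := ⟨ha, fun b hb' => not_lt.1 (hmin b hb')⟩
  exact ⟨a, fun n => ha (mem_range_self n), tendsto_atTop_isLUB hu hlub⟩

/-- If every sequence is bounded, then continuous real-valued functions are eventually constant. -/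
theorem Continuous.exists_forall_ge_eq [Nonempty X] (hb : ∀ u : ℕ → X, BddAbove (range u))
    {f : X → ℝ} (hf : Continuous f) : ∃ a, ∀ x, a ≤ x → f x = f a := by
  have key : ∀ ε : ℝ, 0 < ε → ∃ a, ∀ x, a ≤ x → dist (f x) (f a) ≤ ε := by
    intro ε hε
    by_contra! hcon
    choose s hs hsε using hcon
    let u : ℕ → X := fun n => s^[n] (Classical.arbitrary X)
    have hsucc : ∀ n, u (n + 1) = s (u n) := fun n => Function.iterate_succ_apply' s n _
    have hmono : Monotone u := monotone_nat_of_le_succ fun n => (hs (u n)).trans_eq (hsucc n).symm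
    obtain ⟨a, -, ha⟩ := hmono.exists_tendsto_of_bddAbove (hb u)
    have h1 : Tendsto (fun n => f (u n)) atTop (𝓝 (f a)) := (hf.tendsto a).comp ha
    have h2 := ((tendsto_add_atTop_iff_nat 1).2 h1).dist h1
    rw [dist_self] at h2
    obtain ⟨n, hn⟩ := (h2.eventually_lt_const hε).exists
    rw [hsucc] at hn
    exact (hsε (u n)).not_gt hn
  choose a ha using fun n : ℕ => key (1 / ((n : ℝ) + 1)) Nat.one_div_pos_of_nat
  obtain ⟨b, hab⟩ := hb a
  have hab' : ∀ n, a n ≤ b := fun n => hab (mem_range_self n)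
  refine ⟨b, fun x hx => dist_le_zero.1 ?_⟩
  have hlim : Tendsto (fun n : ℕ => 1 / ((n : ℝ) + 1) + 1 / ((n : ℝ) + 1)) atTop (𝓝 (0 + 0)) :=
    tendsto_one_div_add_atTop_nhds_zero_nat.add tendsto_one_div_add_atTop_nhds_zero_nat
  rw [add_zero] at hlim
  refine ge_of_tendsto' hlim fun n => ?_
  exact (dist_triangle_right _ _ (f (a n))).trans
    (add_le_add (ha n x ((hab' n).trans hx)) (ha n b (hab' n)))

theorem Cp.kappaFrechetUrysohn_of_countable_Iic [Nonempty X] [NoMaxOrder X]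
    (hb : ∀ u : ℕ → X, BddAbove (range u)) (hc : ∀ a : X, (Iic a).Countable) :
    KappaFrechetUrysohn (Cp X) := by
  classical
  intro W hW f hf
  obtain ⟨p, hpW, hp⟩ := exists_seq_of_forall_finset_exists
    (fun q : Cp X × Finset X × ℕ => ∀ h : Cp X, (∀ x ∈ q.2.1, h x = q.1 x) → h ∈ W)
    (fun q r => q.2.2 < r.2.2 ∧ ∀ x ∈ q.2.1, dist (r.1 x) (f x) < 1 / ((r.2.2 : ℝ) + 1))
    (by
      intro s _
      obtain ⟨h, hhW, hh⟩ := ((mem_closure_iff_frequently.1 hf).and_eventually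
        (Cp.eventually_dist_lt f (s.biUnion fun q => q.2.1)
          (Nat.one_div_pos_of_nat (n := s.sup (fun q => q.2.2) + 1)))).exists
      obtain ⟨G, hG⟩ := Cp.exists_finset_of_isOpen hW hhW
      exact ⟨(h, G, s.sup (fun q => q.2.2) + 1), hG, fun q hq =>
        ⟨Nat.lt_succ_of_le (Finset.le_sup (f := fun q : Cp X × Finset X × ℕ => q.2.2) hq),
          fun x hx => hh x (Finset.mem_biUnion.2 ⟨q, hq, hx⟩)⟩⟩)
  have hk : StrictMono fun n => (p n).2.2 := fun m n hmn => (hp m n hmn).1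
  choose b hbG using fun n => (p n).2.1.bddAbove
  obtain ⟨a, ha⟩ := hb b
  have hGa : ∀ n, ∀ x ∈ (p n).2.1, x ≤ a := fun n x hx =>
    (hbG n hx).trans (ha (mem_range_self n))
  obtain ⟨e, he⟩ := (hc a).exists_eq_range ⟨a, le_refl a⟩
  have hea : ∀ n, e n ≤ a := fun n => by
    have : e n ∈ Iic a := he ▸ mem_range_self n
    exact this
  choose u hu hua using fun n => Cp.exists_eqOn_finset f (isClopen_Iic_of_wellFoundedLT a)
    ((p n).2.1 ∪ (Finset.range (n + 1)).image e)
    (by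
      intro x hx
      rcases Finset.mem_union.1 hx with hx | hx
      · exact hGa n x hx
      · obtain ⟨m, -, rfl⟩ := Finset.mem_image.1 hx
        exact hea m)
    (fun x => if x ∈ (p n).2.1 then (p n).1 x else f x)
  refine ⟨u, fun n => hpW n _ fun x hx => ?_, Cp.tendsto_iff.2 fun x => ?_⟩
  · rw [hu n x (Finset.mem_union_left _ hx), if_pos hx]
  by_cases hxa : x ≤ a
  · have hx' : x ∈ range e := he ▸ hxa
    obtain ⟨k, rfl⟩ := hx'
    have hval : ∀ n, k ≤ n → u n (e k) = if e k ∈ (p n).2.1 then (p n).1 (e k) else f (e k) :=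
      fun n hn => hu n _ (Finset.mem_union_right _
        (Finset.mem_image_of_mem e (Finset.mem_range.2 (Nat.lt_succ_of_le hn))))
    by_cases hm : ∃ m, e k ∈ (p m).2.1
    · obtain ⟨m, hm⟩ := hm
      rw [tendsto_iff_dist_tendsto_zero]
      refine squeeze_zero' (Eventually.of_forall fun _ => dist_nonneg) ?_
        (tendsto_one_div_add_atTop_nhds_zero_nat.comp hk.tendsto_atTop)
      filter_upwards [eventually_ge_atTop k, eventually_gt_atTop m] with n hkn hmn
      rw [hval n hkn]
      split_ifs
      · exact ((hp m n hmn).2 _ hm).le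
      · rw [dist_self]
        exact Nat.one_div_pos_of_nat.le
    · push Not at hm
      refine tendsto_const_nhds.congr' ?_
      filter_upwards [eventually_ge_atTop k] with n hkn
      rw [hval n hkn, if_neg (hm n)]
  · exact tendsto_const_nhds.congr fun n => (hua n x hxa).symm

theorem Cp.not_kRSpace_of_bddAbove_range [Nonempty X] [NoMaxOrder X]
    (hb : ∀ u : ℕ → X, BddAbove (range u)) : ¬ KRSpace (Cp X) := by
  classical
  intro hKR
  choose a ha using fun f : Cp X => (Cp.continuous_coe f).exists_forall_ge_eq hb
  -- The functional sending a function to its eventual value is continuous on compact sets.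
  have hcont : Continuous fun f : Cp X => f (a f) := by
    refine hKR _ fun K hK f hf => ?_
    by_contra hcon
    obtain ⟨ε, hε, hfreq⟩ : ∃ ε > 0, ∃ᶠ h in 𝓝[K] f, ε ≤ dist (h (a h)) (f (a f)) := by
      rw [ContinuousWithinAt, Metric.tendsto_nhds] at hcon
      push Not at hcon
      simpa only [not_eventually, not_lt] using hcon
    obtain ⟨p, hpP, hp⟩ := exists_seq_of_forall_finset_exists
      (fun q : Cp X × X × ℕ => q.1 ∈ K ∧ ε ≤ dist (q.1 (a q.1)) (f (a f)) ∧
        a q.1 ≤ q.2.1 ∧ a f ≤ q.2.1)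
      (fun q r => q.2.2 < r.2.2 ∧ q.2.1 ≤ r.2.1 ∧
        dist (r.1 q.2.1) (f q.2.1) < 1 / ((r.2.2 : ℝ) + 1))
      (by
        intro s _
        obtain ⟨h, ⟨hhε, hh⟩, hhK⟩ := ((hfreq.and_eventually
          ((Cp.eventually_dist_lt f (s.image fun q => q.2.1)
            (Nat.one_div_pos_of_nat (n := s.sup (fun q => q.2.2) + 1))).filter_mono
              nhdsWithin_le_nhds)).and_eventually self_mem_nhdsWithin).exists
        obtain ⟨b, hbs⟩ := (s.image fun q => q.2.1).bddAbove
        refine ⟨(h, max b (max (a h) (a f)), s.sup (fun q => q.2.2) + 1), ⟨hhK, hhε,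
          (le_max_left _ _).trans (le_max_right _ _),
          (le_max_right _ _).trans (le_max_right _ _)⟩, fun q hq => ⟨?_, ?_, ?_⟩⟩
        · exact Nat.lt_succ_of_le (Finset.le_sup (f := fun q : Cp X × X × ℕ => q.2.2) hq)
        · exact (hbs (Finset.mem_image_of_mem (fun q : Cp X × X × ℕ => q.2.1) hq)).trans
            (le_max_left _ _)
        · exact hh _ (Finset.mem_image_of_mem (fun q : Cp X × X × ℕ => q.2.1) hq))
    have hk : StrictMono fun n => (p n).2.2 := fun m n hmn => (hp m n hmn).1
    have hmono : Monotone fun n => (p n).2.1 :=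
      monotone_nat_of_le_succ fun n => (hp n (n + 1) n.lt_succ_self).2.1
    obtain ⟨b, hub, hlim⟩ := hmono.exists_tendsto_of_bddAbove (hb _)
    obtain ⟨g, -, hg⟩ := hK (f := map (fun n => (p n).1) atTop)
      (tendsto_principal.2 (Eventually.of_forall fun n => (hpP n).1))
    have hcl : ∀ x, MapClusterPt (g x) atTop (fun n => (p n).1 x) := fun x =>
      MapClusterPt.continuousAt_comp (Cp.continuous_eval x).continuousAt hg
    have hgf : ∀ m, g (p m).2.1 = f (p m).2.1 := fun m => by
      have htend : Tendsto (fun n => (p n).1 (p m).2.1) atTop (𝓝 (f (p m).2.1)) := by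
        rw [tendsto_iff_dist_tendsto_zero]
        refine squeeze_zero' (Eventually.of_forall fun _ => dist_nonneg) ?_
          (tendsto_one_div_add_atTop_nhds_zero_nat.comp hk.tendsto_atTop)
        filter_upwards [eventually_gt_atTop m] with n hmn
        exact (hp m n hmn).2.2.le
      have hne : (𝓝 (g (p m).2.1) ⊓ 𝓝 (f (p m).2.1)).NeBot :=
        (hcl (p m).2.1).neBot.mono (inf_le_inf_left _ htend)
      exact eq_of_nhds_neBot hne
    have hgb : g b = f b := by
      refine tendsto_nhds_unique (((Cp.continuous_coe g).tendsto b).comp hlim) ?_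
      refine (((Cp.continuous_coe f).tendsto b).comp hlim).congr fun m => ?_
      exact (hgf m).symm
    have hfb : f b = f (a f) := ha f b ((hpP 0).2.2.2.trans (hub 0))
    obtain ⟨n, hn⟩ := ((hcl b).frequently (Metric.ball_mem_nhds _ hε)).exists
    have hnb : (p n).1 b = (p n).1 (a (p n).1) := ha _ b ((hpP n).2.2.1.trans (hub n))
    have hlt : dist ((p n).1 b) (g b) < ε := hn
    rw [hnb, hgb, hfb] at hlt
    exact (hpP n).2.1.not_gt hlt
  let z : Cp X := (0 : C(X, ℝ))
  obtain ⟨s, hs⟩ := Cp.exists_finset_of_isOpen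
    (isOpen_lt hcont (continuous_const (y := (1 : ℝ)))) (f := z) (show (0 : ℝ) < 1 from one_pos)
  obtain ⟨b, hbs⟩ := s.bddAbove
  obtain ⟨h, hh, hh'⟩ := Cp.exists_eqOn_finset (show C(X, ℝ) from 1)
    (isClopen_Iic_of_wellFoundedLT b) s (fun x hx => hbs hx) 0
  have hlt : h (a h) < 1 := hs h hh
  obtain ⟨c, hc⟩ := exists_gt (max b (a h))
  have h1 : h c = 1 := hh' c (not_le.2 ((le_max_left _ _).trans_lt hc))
  rw [← ha h c ((le_max_right _ _).trans hc.le), h1] at hlt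
  exact lt_irrefl _ hlt

end LinearOrder

instance nonempty_Iio_ord_aleph_one : Nonempty (Iio (Cardinal.aleph 1).ord) :=
  ⟨⟨0, (Cardinal.isSuccLimit_ord (Cardinal.aleph0_le_aleph 1)).bot_lt⟩⟩

instance noMaxOrder_Iio_ord_aleph_one : NoMaxOrder (Iio (Cardinal.aleph 1).ord) :=
  ⟨fun a => ⟨⟨Order.succ a.1,
    (Cardinal.isSuccLimit_ord (Cardinal.aleph0_le_aleph 1)).succ_lt a.2⟩, Order.lt_succ a.1⟩⟩

theorem bddAbove_range_Iio_ord_aleph_one (u : ℕ → Iio (Cardinal.aleph 1).ord) :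
    BddAbove (range u) := by
  have hlt : ⨆ n, (u n).1 < (Cardinal.aleph 1).ord := by
    have hu : ∀ n, (u n).1 < Ordinal.omega 1 := fun n => Cardinal.ord_aleph 1 ▸ (u n).2
    exact (Ordinal.iSup_lt_omega_one hu).trans_eq (Cardinal.ord_aleph 1).symm
  refine ⟨⟨_, hlt⟩, ?_⟩
  rintro _ ⟨n, rfl⟩
  exact Ordinal.le_iSup (fun n => (u n).1) n

theorem countable_Iic_Iio_ord_aleph_one (a : Iio (Cardinal.aleph 1).ord) :
    (Iic a).Countable := by
  have hcard : (Order.succ a.1).card < Cardinal.aleph 1 := Cardinal.lt_ord.1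
    ((Cardinal.isSuccLimit_ord (Cardinal.aleph0_le_aleph 1)).succ_lt a.2)
  have hcount : (Iio (Order.succ a.1)).Countable := by
    rw [← Cardinal.le_aleph0_iff_set_countable, Cardinal.mk_Iio_ordinal, Cardinal.lift_le_aleph0]
    exact Order.lt_succ_iff.1 (hcard.trans_eq Cardinal.succ_aleph0.symm)
  refine (hcount.preimage Subtype.val_injective).mono fun x hx => ?_
  exact Order.lt_succ_of_le (show x.1 ≤ a.1 from hx)

/-- The space `C_p(ω₁)`, where `ω₁` is the first uncountable ordinal, is an Ascoli
space but not a `k_ℝ`-space. -/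
theorem cp_omega1_ascoli_not_kR :
    AscoliSpace (Cp (Set.Iio (Cardinal.aleph 1).ord)) ∧
      ¬ KRSpace (Cp (Set.Iio (Cardinal.aleph 1).ord)) := by
  exact ⟨Cp.ascoliSpace_of_kappaFrechetUrysohn (Cp.kappaFrechetUrysohn_of_countable_Iic
    bddAbove_range_Iio_ord_aleph_one countable_Iic_Iio_ord_aleph_one),
    Cp.not_kRSpace_of_bddAbove_range bddAbove_range_Iio_ord_aleph_one⟩
end
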